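/- Let ω ∉ {ε, ab, ba, aba} be a factor of F_∞ and let k be the unique index with f_k ≤ |ω| < f_{k+1}. Then the singular kernel sk(ω) is one of s_k, s_{k-1}, s_{k-2}; consequently the six types T1.1, T1.2, T1.3, T2.1, T2.2, T2.3 are pairwise disjoint, the set of factors of length exactly f_k is the disjoint union T1.1 ⊔ T1.2 ⊔ T1.3, and the set of factors of length strictly between f_k and f_{k+1} is the disjoint union T2.1 ⊔ T2.2 ⊔ T2.3. -/

import Mathlib

/-- Finite Fibonacci words: `Fw k = σ^k(a)` where `a = false`, `b = true`,
`σ(a) = ab`, `σ(b) = a`; so `Fw (k+2) = Fw (k+1) ++ Fw k`. -/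
def Fw : ℕ → List Bool
  | 0 => [false]
  | 1 => [false, true]
  | (k+2) => Fw (k+1) ++ Fw k

/-- The infinite Fibonacci word `F_∞` (0-indexed): since `Fw (n+1)` has length
`fib (n+3) > n`, its `n`-th letter is the `n`-th letter of `F_∞`. -/
def fw (n : ℕ) : Bool := (Fw (n+1)).getD n false

/-- Singular words, with index shifted by one: `sw n = s_{n-1}`.
`sw 0 = s_{-1} = a`, and `sw (n+1) = s_n = β_n · F_n · α_n⁻¹` where
`α_n` is the last letter of `F_n` and `β_n` the other letter. -/
def sw : ℕ → List Bool
  | 0 => [false]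
  | (n+1) => (!((Fw n).getLastD false)) :: (Fw n).dropLast

/-- The factor of `F_∞` of length `n` starting at (0-indexed) position `i`. -/
def seg (i n : ℕ) : List Bool := (List.range n).map (fun t => fw (i + t))

/-- `w` occurs in `F_∞` at (0-indexed) position `i`. -/
def OccursAt (w : List Bool) (i : ℕ) : Prop := seg i w.length = w

/-- `w` is a factor of `F_∞`. -/
def IsFactor (w : List Bool) : Prop := ∃ i, OccursAt w i

/-- Starting position of the `(p+1)`-st occurrence of `w` in `F_∞`
(occurrences enumerated by starting position, 0-indexed: `occPos w 0`
is the first occurrence, i.e. the paper's `ω_1`). -/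
noncomputable def occPos (w : List Bool) (p : ℕ) : ℕ := Nat.nth (OccursAt w) p

/-- A finite word viewed as an element of the free group on the alphabet. -/
def listToFree (w : List Bool) : FreeGroup Bool := (w.map FreeGroup.of).prod

/-- The gap `ν_{w,p}` (0-indexed in `p`: `gap w 0` is the paper's `ν_{w,1}`)
between the `(p+1)`-st and `(p+2)`-nd occurrences of `w`, as an element of the
free group: the separating word if the occurrences are separated or adjacent,
and the formal inverse of the overlap if they overlap. -/
noncomputable def gap (w : List Bool) (p : ℕ) : FreeGroup Bool :=
  if occPos w p + w.length ≤ occPos w (p+1) then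
    listToFree (seg (occPos w p + w.length) (occPos w (p+1) - (occPos w p + w.length)))
  else
    (listToFree (seg (occPos w (p+1)) (occPos w p + w.length - occPos w (p+1))))⁻¹

/-- The signed length `|ν_{w,p}|` of the gap (negative in the overlapped case). -/
noncomputable def gapLen (w : List Bool) (p : ℕ) : ℤ :=
  (occPos w (p+1) : ℤ) - ((occPos w p : ℤ) + (w.length : ℤ))

/-- `u` is a singular word (some `s_k`, `k ≥ -1`). -/
def IsSingular (u : List Bool) : Prop := ∃ n, u = sw n

/-- `u` is a singular kernel of `w`: a singular factor of `w` of maximal length. -/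
def IsKernelOf (u w : List Bool) : Prop :=
  IsSingular u ∧ u <:+: w ∧ ∀ v : List Bool, IsSingular v → v <:+: w → v.length ≤ u.length

/-- The excluded words `{ε, ab, ba, aba}`. -/
def excl : List (List Bool) := [[], [false, true], [true, false], [false, true, false]]

/-- The `i`-th conjugate `C_i(w)` (indices taken mod the length). -/
def conj (i : ℕ) (w : List Bool) : List Bool :=
  w.drop (i % w.length) ++ w.take (i % w.length)

/-- `sliceW u i j = u[i,j]`, the letters `i` through `j` of `u`, 1-indexed. -/
def sliceW (u : List Bool) (i j : ℕ) : List Bool := (u.take j).drop (i - 1)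

/-- Type T1.1: `|ω| = f_k` and `sk(ω) = s_k`. -/
def T11 (k : ℕ) (ω : List Bool) : Prop :=
  IsFactor ω ∧ ω ∉ excl ∧ ω.length = Nat.fib (k+2) ∧ IsKernelOf (sw (k+1)) ω

/-- Type T1.2: `|ω| = f_k` and `sk(ω) = s_{k-1}`. -/
def T12 (k : ℕ) (ω : List Bool) : Prop :=
  IsFactor ω ∧ ω ∉ excl ∧ ω.length = Nat.fib (k+2) ∧ IsKernelOf (sw k) ω

/-- Type T1.3: `|ω| = f_k` and `sk(ω) = s_{k-2}` (which requires `k ≥ 1`). -/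
def T13 (k : ℕ) (ω : List Bool) : Prop :=
  IsFactor ω ∧ ω ∉ excl ∧ ω.length = Nat.fib (k+2) ∧ 1 ≤ k ∧ IsKernelOf (sw (k-1)) ω

/-- Type T2.1: `f_k < |ω| < f_{k+1}` and `sk(ω) = s_k`. -/
def T21 (k : ℕ) (ω : List Bool) : Prop :=
  IsFactor ω ∧ ω ∉ excl ∧ Nat.fib (k+2) < ω.length ∧ ω.length < Nat.fib (k+3) ∧
    IsKernelOf (sw (k+1)) ω

/-- Type T2.2: `f_k < |ω| < f_{k+1}` and `sk(ω) = s_{k-1}`. -/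
def T22 (k : ℕ) (ω : List Bool) : Prop :=
  IsFactor ω ∧ ω ∉ excl ∧ Nat.fib (k+2) < ω.length ∧ ω.length < Nat.fib (k+3) ∧
    IsKernelOf (sw k) ω

/-- Type T2.3: `f_k < |ω| < f_{k+1}` and `sk(ω) = s_{k-2}` (which requires `k ≥ 1`). -/
def T23 (k : ℕ) (ω : List Bool) : Prop :=
  IsFactor ω ∧ ω ∉ excl ∧ Nat.fib (k+2) < ω.length ∧ ω.length < Nat.fib (k+3) ∧
    1 ≤ k ∧ IsKernelOf (sw (k-1)) ω

theorem length_Fw (n : ℕ) : (Fw n).length = Nat.fib (n + 2) := by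
  induction n using Fw.induct with
  | case1 => rfl
  | case2 => rfl
  | case3 k ih1 ih2 =>
    rw [Fw, List.length_append, ih1, ih2, Nat.fib_add_two (n := k + 2), add_comm]

theorem length_sw (n : ℕ) : (sw n).length = Nat.fib (n + 1) := by
  cases n with
  | zero => rfl
  | succ n =>
    have : 0 < Nat.fib (n + 2) := Nat.fib_pos.2 (by omega)
    simp only [sw, List.length_cons, List.length_dropLast, length_Fw]
    exact Nat.sub_add_cancel this

theorem exists_Fw_eq_cons (n : ℕ) : ∃ t, Fw n = false :: t := by
  induction n using Fw.induct with
  | case1 => exact ⟨_, rfl⟩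
  | case2 => exact ⟨_, rfl⟩
  | case3 k ih1 ih2 =>
    obtain ⟨t, ht⟩ := ih1
    exact ⟨t ++ Fw k, by rw [Fw, ht, List.cons_append]⟩

/-- The last letter of `Fw n` is determined by the parity of `n`. -/
theorem Fw_eq_dropLast_append (n : ℕ) :
    Fw n = (Fw n).dropLast ++ [decide (n % 2 = 1)] := by
  induction n using Fw.induct with
  | case1 => rfl
  | case2 => rfl
  | case3 k ih1 ih2 =>
    have hne : Fw k ≠ [] := by
      obtain ⟨t, ht⟩ := exists_Fw_eq_cons k
      simp [ht]
    rw [Fw, List.dropLast_append_of_ne_nil hne, List.append_assoc,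
      show k.succ.succ % 2 = k % 2 from Nat.add_mod_right k 2, ← ih2]

theorem sw_succ (n : ℕ) : sw (n + 1) = (!decide (n % 2 = 1)) :: (Fw n).dropLast := by
  have h : (Fw n).getLastD false = decide (n % 2 = 1) := by
    rw [Fw_eq_dropLast_append n]; simp
  rw [sw, h]

theorem Fw_prefix_succ (n : ℕ) : Fw n <+: Fw (n + 1) := by
  cases n with
  | zero => exact ⟨[true], rfl⟩
  | succ n => exact ⟨Fw n, rfl⟩

theorem Fw_prefix_of_le {m n : ℕ} (h : m ≤ n) : Fw m <+: Fw n := by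
  induction n, h using Nat.le_induction with
  | base => exact List.prefix_refl _
  | succ n _ ih => exact ih.trans (Fw_prefix_succ n)

theorem lt_length_Fw (n : ℕ) : n < (Fw n).length := by
  induction n using Fw.induct with
  | case1 => decide
  | case2 => decide
  | case3 k ih1 ih2 =>
    rw [Fw, List.length_append]
    omega

theorem fw_eq_getElem {t N : ℕ} (h : t < N) :
    fw t = (Fw N)[t]'(h.trans (lt_length_Fw N)) := by
  have ht : t < (Fw (t + 1)).length := (Nat.lt_succ_self t).trans (lt_length_Fw _)
  rw [fw, List.getD_eq_getElem _ _ ht]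
  exact (Fw_prefix_of_le (Nat.succ_le_of_lt h)).getElem ht

theorem IsFactor.infix_Fw {w : List Bool} (hw : IsFactor w) : ∃ N, w <:+: Fw N := by
  obtain ⟨i, hi⟩ := hw
  refine ⟨i + w.length, ?_⟩
  have hlen := lt_length_Fw (i + w.length)
  have h : w = ((Fw (i + w.length)).drop i).take w.length := by
    conv_lhs => rw [← hi]
    apply List.ext_getElem
    · simp only [seg, List.length_map, List.length_range, List.length_take, List.length_drop]
      omega
    · intro t h1 h2
      have ht : t < w.length := by simpa [seg] using h1
      simp only [seg, List.getElem_map, List.getElem_range, List.getElem_take, List.getElem_drop]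
      exact fw_eq_getElem (by omega)
  have hinf : ((Fw (i + w.length)).drop i).take w.length <:+: Fw (i + w.length) :=
    (List.take_prefix _ _).isInfix.trans (List.drop_suffix _ _).isInfix
  rwa [← h] at hinf

theorem isChain_Fw (n : ℕ) : (Fw n).IsChain (fun c d => ¬(c = true ∧ d = true)) := by
  induction n using Fw.induct with
  | case1 => simp [Fw]
  | case2 => simp [Fw]
  | case3 k ih1 ih2 =>
    rw [Fw, List.isChain_append]
    refine ⟨ih1, ih2, ?_⟩
    obtain ⟨t, ht⟩ := exists_Fw_eq_cons k
    simp [ht]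

/-- The blocks `Fw (j + 1)` and `Fw j` into which the Fibonacci word is cut. -/
def fibBlock (j : ℕ) : Bool → List Bool
  | false => Fw (j + 1)
  | true => Fw j

theorem flatMap_fibBlock_Fw (j n : ℕ) : (Fw n).flatMap (fibBlock j) = Fw (j + 1 + n) := by
  induction n using Fw.induct with
  | case1 => simp [Fw, fibBlock]
  | case2 => simp [Fw, fibBlock]
  | case3 k ih1 ih2 =>
    rw [Fw, List.flatMap_append, ih1, ih2]
    rfl

/-- An occurrence of `s` that lies within the span of an occurrence of `w`. -/
theorem isInfix_of_append_eq_append {α : Type*} {x w y u s r : List α}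
    (h : x ++ w ++ y = u ++ s ++ r) (hx : x.length ≤ u.length)
    (hs : u.length + s.length ≤ x.length + w.length) : s <:+: w := by
  have hp : u ++ s <+: x ++ w :=
    List.prefix_of_prefix_length_le (l₃ := u ++ s ++ r) (List.prefix_append _ _)
      (h ▸ List.prefix_append _ _) (by simpa using hs)
  obtain ⟨z, rfl⟩ : x <+: u :=
    List.prefix_of_prefix_length_le (List.prefix_append x w)
      ((List.prefix_append u s).trans hp) hx
  obtain ⟨r', hr⟩ := hp
  refine ⟨z, r', ?_⟩
  simpa [List.append_assoc] using hr

/-- Around every block boundary there is a singular word, starting one letter before it. -/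
theorem exists_singular_at_boundary (j : ℕ) {c d : Bool} (hcd : ¬(c = true ∧ d = true)) :
    ∃ u s r, (s = sw (j + 1) ∨ s = sw (j + 2)) ∧ fibBlock j c ++ fibBlock j d = u ++ s ++ r ∧
      u.length + 1 = (fibBlock j c).length ∧ u.length + s.length ≤ Nat.fib (j + 4) := by
  have hj := Fw_eq_dropLast_append j
  have hj1 := Fw_eq_dropLast_append (j + 1)
  have hlj := congrArg List.length hj
  have hlj1 := congrArg List.length hj1
  have hpar : decide ((j + 1) % 2 = 1) = !decide (j % 2 = 1) := by
    rcases Nat.mod_two_eq_zero_or_one j with h | h <;> simp [h, Nat.add_mod]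
  have hfib : Nat.fib (j + 4) = Nat.fib (j + 2) + Nat.fib (j + 3) := Nat.fib_add_two
  rw [List.length_append, List.length_singleton, length_Fw] at hlj hlj1
  rw [hpar] at hj1
  have hs1 := sw_succ j
  have hs2 := sw_succ (j + 1)
  rw [hpar, Bool.not_not] at hs2
  have hsl1 := length_sw (j + 1)
  have hsl2 := length_sw (j + 2)
  simp only [Nat.add_assoc, Nat.reduceAdd] at *
  rcases c with _ | _ <;> rcases d with _ | _
  · obtain ⟨r, hr⟩ := Fw_prefix_succ j
    refine ⟨(Fw (j + 1)).dropLast, sw (j + 1), decide (j % 2 = 1) :: r, Or.inl rfl, ?_, ?_, ?_⟩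
    · rw [hs1]
      calc Fw (j + 1) ++ Fw (j + 1) = Fw (j + 1) ++ (Fw j ++ r) := by rw [hr]
        _ = ((Fw (j + 1)).dropLast ++ [!decide (j % 2 = 1)]) ++
            (((Fw j).dropLast ++ [decide (j % 2 = 1)]) ++ r) := by rw [← hj, ← hj1]
        _ = _ := by simp
    · simp only [fibBlock, length_Fw, Nat.add_assoc, Nat.reduceAdd]; omega
    · omega
  · refine ⟨(Fw (j + 1)).dropLast, sw (j + 1), [decide (j % 2 = 1)], Or.inl rfl, ?_, ?_, ?_⟩
    · rw [hs1]
      calc Fw (j + 1) ++ Fw j = ((Fw (j + 1)).dropLast ++ [!decide (j % 2 = 1)]) ++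
            ((Fw j).dropLast ++ [decide (j % 2 = 1)]) := by rw [← hj, ← hj1]
        _ = _ := by simp
    · simp only [fibBlock, length_Fw, Nat.add_assoc, Nat.reduceAdd]; omega
    · omega
  · refine ⟨(Fw j).dropLast, sw (j + 2), [!decide (j % 2 = 1)], Or.inr rfl, ?_, ?_, ?_⟩
    · rw [hs2]
      calc Fw j ++ Fw (j + 1) = ((Fw j).dropLast ++ [decide (j % 2 = 1)]) ++
            ((Fw (j + 1)).dropLast ++ [!decide (j % 2 = 1)]) := by rw [← hj, ← hj1]
        _ = _ := by simp
    · simp only [fibBlock, length_Fw]; omega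
    · omega
  · simp at hcd

theorem length_fibBlock_le (j : ℕ) (c : Bool) : (fibBlock j c).length ≤ Nat.fib (j + 3) := by
  cases c
  · exact (length_Fw (j + 1)).le
  · exact (length_Fw j).le.trans (Nat.fib_mono (by omega))

theorem singular_infix_of_infix_flatMap (j : ℕ) {w : List Bool}
    (hw : Nat.fib (j + 4) ≤ w.length) (l : List Bool) :
    ∀ c, (c :: l).IsChain (fun c d => ¬(c = true ∧ d = true)) →
      w <:+: (c :: l).flatMap (fibBlock j) → sw (j + 1) <:+: w ∨ sw (j + 2) <:+: w := by
  induction l with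
  | nil =>
    intro c _ hinf
    have h1 := hinf.length_le
    have h2 := length_fibBlock_le j c
    have h3 : Nat.fib (j + 3) < Nat.fib (j + 4) := (Nat.fib_lt_fib (by omega)).2 (by omega)
    simp only [List.flatMap_cons, List.flatMap_nil, List.append_nil] at h1
    omega
  | cons d l ih =>
    intro c hc hinf
    rw [List.isChain_cons_cons] at hc
    obtain ⟨x, y, hxy⟩ := hinf
    by_cases hx : (fibBlock j c).length ≤ x.length
    · apply ih d hc.2
      rw [List.flatMap_cons, List.append_assoc] at hxy
      obtain ⟨x', rfl⟩ : fibBlock j c <+: x :=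
        List.prefix_of_prefix_length_le (List.prefix_append _ _)
          (hxy ▸ List.prefix_append x (w ++ y)) hx
      refine ⟨x', y, ?_⟩
      rw [List.append_assoc, List.append_cancel_left_eq] at hxy
      rw [← hxy, List.append_assoc]
    · obtain ⟨u, s, r, hs, heq, hu, hus⟩ := exists_singular_at_boundary j hc.1
      have hsw : s <:+: w := by
        refine isInfix_of_append_eq_append (y := y) (r := r ++ l.flatMap (fibBlock j))
          (x := x) (u := u) ?_ (by omega) (by omega)
        rw [hxy, List.flatMap_cons, List.flatMap_cons, ← List.append_assoc, heq]
        simp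
      rcases hs with rfl | rfl
      · exact Or.inl hsw
      · exact Or.inr hsw

/-- A factor of length at least `f_{j+2}` contains `s_j` or `s_{j+1}`. -/
theorem IsFactor.singular_infix {w : List Bool} (hf : IsFactor w) (j : ℕ)
    (hw : Nat.fib (j + 4) ≤ w.length) : sw (j + 1) <:+: w ∨ sw (j + 2) <:+: w := by
  obtain ⟨N, hN⟩ := hf.infix_Fw
  obtain ⟨t, ht⟩ := exists_Fw_eq_cons N
  have hinf : w <:+: (Fw N).flatMap (fibBlock j) := by
    rw [flatMap_fibBlock_Fw]
    exact hN.trans (Fw_prefix_of_le (by omega)).isInfix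
  rw [ht] at hinf
  exact singular_infix_of_infix_flatMap j hw t false (ht ▸ isChain_Fw N) hinf

theorem IsFactor.isChain {w : List Bool} (hf : IsFactor w) :
    w.IsChain (fun c d => ¬(c = true ∧ d = true)) := by
  obtain ⟨N, hN⟩ := hf.infix_Fw
  exact (isChain_Fw N).infix hN

theorem exists_isKernelOf {w : List Bool} (hw : w ≠ []) : ∃ u, IsKernelOf u w := by
  have hfin : {v | IsSingular v ∧ v <:+: w}.Finite :=
    (List.finite_toSet w.sublists).subset fun v hv => List.mem_sublists.2 hv.2.sublist
  have hne : {v | IsSingular v ∧ v <:+: w}.Nonempty := by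
    obtain ⟨c, l, rfl⟩ := List.exists_cons_of_ne_nil hw
    refine ⟨[c], ?_, [], l, rfl⟩
    cases c
    · exact ⟨0, rfl⟩
    · exact ⟨1, rfl⟩
  obtain ⟨u, hu, hmax⟩ := Set.exists_max_image _ List.length hfin hne
  exact ⟨u, hu.1, hu.2, fun v hv hvw => hmax v ⟨hv, hvw⟩⟩

theorem two_le_length_kernel {u w : List Bool} (hf : IsFactor w) (he : w ∉ excl)
    (h3 : 3 ≤ w.length) (h5 : w.length < 5) (hu : IsKernelOf u w) : 2 ≤ u.length := by
  have hchain := hf.isChain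
  have hsw : sw 2 <:+: w ∨ sw 3 <:+: w := by
    match w, h3, h5 with
    | [x, y, z], _, _ =>
      revert he hchain
      clear hf hu
      revert x y z
      decide
    | [x, y, z, t], _, _ =>
      revert he hchain
      clear hf hu
      revert x y z t
      decide
  rcases hsw with h | h
  · exact hu.2.2 _ ⟨2, rfl⟩ h
  · exact (by decide : 2 ≤ (sw 3).length).trans (hu.2.2 _ ⟨3, rfl⟩ h)

theorem kernel_cases {k : ℕ} {w u : List Bool} (hf : IsFactor w) (he : w ∉ excl)
    (h1 : Nat.fib (k + 2) ≤ w.length) (h2 : w.length < Nat.fib (k + 3)) (hu : IsKernelOf u w) :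
    u = sw (k + 1) ∨ u = sw k ∨ (1 ≤ k ∧ u = sw (k - 1)) := by
  obtain ⟨n, rfl⟩ := hu.1
  have hupper : n ≤ k + 1 := by
    by_contra! h
    have hle := hu.2.1.length_le
    rw [length_sw] at hle
    have := Nat.fib_mono (show k + 3 ≤ n + 1 by omega)
    omega
  have hlower : k ≤ n + 1 := by
    rcases k with _ | _ | j
    · omega
    · omega
    · by_contra! h
      have hmax : Nat.fib (j + 2) ≤ Nat.fib (n + 1) := by
        rw [← length_sw n]
        rcases hf.singular_infix j h1 with hs | hs
        · rw [← length_sw (j + 1)]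
          exact hu.2.2 _ ⟨_, rfl⟩ hs
        · refine (Nat.fib_mono (Nat.le_succ _)).trans ?_
          rw [← length_sw (j + 2)]
          exact hu.2.2 _ ⟨_, rfl⟩ hs
      rcases j with _ | j
      · obtain rfl : n = 0 := by omega
        exact absurd (two_le_length_kernel hf he h1 h2 hu) (by decide)
      · have hlt : Nat.fib (j + 2) < Nat.fib (j + 3) := (Nat.fib_lt_fib (by omega)).2 (by omega)
        have := Nat.fib_mono (show n + 1 ≤ j + 2 by omega)
        rw [show j + 1 + 2 = j + 3 by rfl] at hmax
        omega
  have : n = k + 1 ∨ n = k ∨ (1 ≤ k ∧ n = k - 1) := by omega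
  rcases this with rfl | rfl | ⟨hk, rfl⟩
  · exact Or.inl rfl
  · exact Or.inr (Or.inl rfl)
  · exact Or.inr (Or.inr ⟨hk, rfl⟩)

theorem fib_eq_of_isKernelOf {m n : ℕ} {w : List Bool} (hm : IsKernelOf (sw m) w)
    (hn : IsKernelOf (sw n) w) : Nat.fib (m + 1) = Nat.fib (n + 1) := by
  rw [← length_sw, ← length_sw]
  exact le_antisymm (hn.2.2 _ hm.1 hm.2.1) (hm.2.2 _ hn.1 hn.2.1)

/-- Only the length-one singular words can both be kernels of the same word. -/
theorem index_eq_zero_of_isKernelOf_succ {n : ℕ} {w : List Bool} (h1 : IsKernelOf (sw (n + 1)) w)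
    (h2 : IsKernelOf (sw n) w) : n = 0 := by
  have h := fib_eq_of_isKernelOf h1 h2
  by_contra hn
  have : Nat.fib (n + 1) < Nat.fib (n + 2) := (Nat.fib_lt_fib (by omega)).2 (by omega)
  simp only [Nat.add_assoc, Nat.reduceAdd] at h
  omega

theorem not_isKernelOf_add_two {n : ℕ} {w : List Bool} (h1 : IsKernelOf (sw (n + 2)) w)
    (h2 : IsKernelOf (sw n) w) : False := by
  have h := fib_eq_of_isKernelOf h1 h2
  have h3 : Nat.fib (n + 3) = Nat.fib (n + 1) + Nat.fib (n + 2) := Nat.fib_add_two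
  have h4 : 0 < Nat.fib (n + 2) := Nat.fib_pos.2 (by omega)
  simp only [Nat.add_assoc, Nat.reduceAdd] at h
  omega

theorem not_isKernelOf_both_of_length_one {w : List Bool} (hw : w.length = 1)
    (h1 : IsKernelOf (sw 1) w) (h0 : IsKernelOf (sw 0) w) : False := by
  have e1 := h1.2.1.eq_of_length (by rw [hw]; rfl)
  have e0 := h0.2.1.eq_of_length (by rw [hw]; rfl)
  exact absurd (e1.trans e0.symm) (by decide)

theorem mem_excl_of_isKernelOf_both {w : List Bool} (hw : w.length = 2)
    (h1 : IsKernelOf (sw 1) w) (h0 : IsKernelOf (sw 0) w) : w ∈ excl := by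
  replace h1 := h1.2.1
  replace h0 := h0.2.1
  match w, hw with
  | [x, y], _ =>
    revert x y
    decide

/-- for a factor `ω ∉ {ε,ab,ba,aba}` with `f_k ≤ |ω| < f_{k+1}`, the
singular kernel of `ω` is `s_k`, `s_{k-1}` or `s_{k-2}`; the six types are pairwise
disjoint; the factors of length `f_k` are exactly `T1.1 ⊔ T1.2 ⊔ T1.3`, and the
factors of length strictly between `f_k` and `f_{k+1}` are exactly `T2.1 ⊔ T2.2 ⊔ T2.3`. -/
theorem stmt10 (k : ℕ) :
    (∀ ω : List Bool, IsFactor ω → ω ∉ excl →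
      Nat.fib (k+2) ≤ ω.length → ω.length < Nat.fib (k+3) →
      ∀ u : List Bool, IsKernelOf u ω →
        u = sw (k+1) ∨ u = sw k ∨ (1 ≤ k ∧ u = sw (k-1))) ∧
    (∀ ω : List Bool,
      ¬(T11 k ω ∧ T12 k ω) ∧ ¬(T11 k ω ∧ T13 k ω) ∧ ¬(T12 k ω ∧ T13 k ω) ∧
      ¬(T21 k ω ∧ T22 k ω) ∧ ¬(T21 k ω ∧ T23 k ω) ∧ ¬(T22 k ω ∧ T23 k ω)) ∧
    (∀ ω : List Bool,
      (IsFactor ω ∧ ω ∉ excl ∧ ω.length = Nat.fib (k+2)) ↔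
        (T11 k ω ∨ T12 k ω ∨ T13 k ω)) ∧
    (∀ ω : List Bool,
      (IsFactor ω ∧ ω ∉ excl ∧ Nat.fib (k+2) < ω.length ∧ ω.length < Nat.fib (k+3)) ↔
        (T21 k ω ∨ T22 k ω ∨ T23 k ω)) := by
  have hne : ∀ {ω : List Bool}, ω ∉ excl → ω ≠ [] := by
    rintro ω h rfl
    exact h (by simp [excl])
  have hlt : Nat.fib (k + 2) < Nat.fib (k + 3) := (Nat.fib_lt_fib (by omega)).2 (by omega)
  refine ⟨fun ω hf he h1 h2 u hu => kernel_cases hf he h1 h2 hu, ?_, ?_, ?_⟩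
  · intro ω
    refine ⟨?_, ?_, ?_, ?_, ?_, ?_⟩
    · rintro ⟨⟨_, _, hl, hu⟩, _, _, _, hv⟩
      obtain rfl := index_eq_zero_of_isKernelOf_succ hu hv
      exact not_isKernelOf_both_of_length_one hl hu hv
    · rintro ⟨⟨_, _, _, hu⟩, _, _, _, hk, hv⟩
      obtain ⟨n, rfl⟩ := Nat.exists_eq_add_of_le' hk
      exact not_isKernelOf_add_two hu hv
    · rintro ⟨⟨_, he, hl, hu⟩, _, _, _, hk, hv⟩
      obtain ⟨n, rfl⟩ := Nat.exists_eq_add_of_le' hk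
      obtain rfl := index_eq_zero_of_isKernelOf_succ hu hv
      exact he (mem_excl_of_isKernelOf_both hl hu hv)
    · rintro ⟨⟨_, _, hl, hl', hu⟩, _, _, _, _, hv⟩
      obtain rfl := index_eq_zero_of_isKernelOf_succ hu hv
      simp [Nat.fib] at hl hl'
      omega
    · rintro ⟨⟨_, _, _, _, hu⟩, _, _, _, _, hk, hv⟩
      obtain ⟨n, rfl⟩ := Nat.exists_eq_add_of_le' hk
      exact not_isKernelOf_add_two hu hv
    · rintro ⟨⟨_, _, hl, hl', hu⟩, _, _, _, _, hk, hv⟩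
      obtain ⟨n, rfl⟩ := Nat.exists_eq_add_of_le' hk
      obtain rfl := index_eq_zero_of_isKernelOf_succ hu hv
      simp [Nat.fib] at hl hl'
      omega
  · intro ω
    constructor
    · rintro ⟨hf, he, hl⟩
      obtain ⟨u, hu⟩ := exists_isKernelOf (hne he)
      rcases kernel_cases hf he hl.ge (hl ▸ hlt) hu with rfl | rfl | ⟨hk, rfl⟩
      · exact Or.inl ⟨hf, he, hl, hu⟩
      · exact Or.inr (Or.inl ⟨hf, he, hl, hu⟩)
      · exact Or.inr (Or.inr ⟨hf, he, hl, hk, hu⟩)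
    · rintro (h | h | h) <;> exact ⟨h.1, h.2.1, h.2.2.1⟩
  · intro ω
    constructor
    · rintro ⟨hf, he, hl, hl'⟩
      obtain ⟨u, hu⟩ := exists_isKernelOf (hne he)
      rcases kernel_cases hf he hl.le hl' hu with rfl | rfl | ⟨hk, rfl⟩
      · exact Or.inl ⟨hf, he, hl, hl', hu⟩
      · exact Or.inr (Or.inl ⟨hf, he, hl, hl', hu⟩)
      · exact Or.inr (Or.inr ⟨hf, he, hl, hl', hk, hu⟩)
    · rintro (h | h | h) <;> exact ⟨h.1, h.2.1, h.2.2.1, h.2.2.2.1⟩
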